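/- Let N ≥ 1, 1 ≤ K ≤ N, h : Fin N → ℝ with all values positive and pairwise distinct, and λ : Fin N → ℝ with 0 < λ i for all i. Let σ(1), …, σ(K) be the indices of the K largest values of h in strictly descending order, and for each k let S_k = Fin N \ {σ(1), …, σ(k−1)} be the set of clients remaining before the k-th draw. Then the probability of sequentially sampling without replacement exactly the clients σ(1), …, σ(K) in this order, namely ∏_{k=1}^{K} [ λ_{σ(k)} * (h_{σ(k)})^C / (∑_{j ∈ S_k} λ j * (h j)^C) ], tends to 1 as the real exponent C → ∞. -/

import Mathlib

open Filter Finset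

/-- Under weights `w j * h j ^ C`, the draw of the strict maximiser of `h` on `s` becomes certain
as `C → ∞`. -/
theorem tendsto_weighted_rpow_div_sum {ι : Type*} {s : Finset ι} {h w : ι → ℝ} {i : ι}
    (hi : i ∈ s) (hpos : ∀ j ∈ s, 0 < h j) (hw : w i ≠ 0)
    (hmax : ∀ j ∈ s, j ≠ i → h j < h i) :
    Tendsto (fun C : ℝ => w i * h i ^ C / ∑ j ∈ s, w j * h j ^ C) atTop (nhds 1) := by
  classical
  have hhi := hpos i hi
  have hterm : ∀ j ∈ s, Tendsto (fun C : ℝ => w j / w i * (h j / h i) ^ C) atTop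
      (nhds (if j = i then 1 else 0)) := by
    intro j hj
    split_ifs with hji
    · subst hji
      simp [hw, hhi.ne']
    · have hlt : h j / h i < 1 := (div_lt_one hhi).2 (hmax j hj hji)
      have hgt : -1 < h j / h i := by linarith [div_pos (hpos j hj) hhi]
      simpa using (tendsto_rpow_atTop_of_base_lt_one _ hgt hlt).const_mul (w j / w i)
  have hsum := (tendsto_finsetSum s hterm).inv₀ (by simp [hi])
  simp only [sum_ite_eq', hi, if_true, inv_one] at hsum
  refine hsum.congr fun C => ?_
  rw [← inv_div, sum_div]
  congr 1
  refine sum_congr rfl fun j hj => ?_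
  rw [Real.div_rpow (hpos j hj).le hhi.le, div_mul_div_comm]

/-- Proposition 2: Top-`K` greedy selection in the limit. Let `σ 0, …, σ (K-1)`
be the indices of the `K` largest (pairwise-distinct, positive) channel values, listed in
strictly descending order of `h`, and let `S k` be the set of clients remaining before the
`k`-th sequential draw. Then the probability of sequentially sampling without replacement
exactly the clients `σ 0, …, σ (K-1)` in this order, namely
`∏ k, λ (σ k) * (h (σ k))^C / (∑_{j ∈ S k} λ j * (h j)^C)`, tends to `1` as `C → ∞`. -/
theorem caafl_top_K_greedy_limit (N K : ℕ) (hN : 1 ≤ N) (hK : 1 ≤ K) (hKN : K ≤ N)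
    (h lam : Fin N → ℝ) (hpos : ∀ i, 0 < h i) (hinj : Function.Injective h)
    (lampos : ∀ i, 0 < lam i)
    (σ : Fin K → Fin N)
    (hdesc : ∀ k l : Fin K, k < l → h (σ l) < h (σ k))
    (htop : ∀ i : Fin N, i ∉ Set.range σ → ∀ k : Fin K, h i < h (σ k))
    (S : Fin K → Finset (Fin N))
    (hS : ∀ k : Fin K, S k = univ.filter (fun j => ∀ l : Fin K, l < k → j ≠ σ l)) :
    Tendsto
      (fun C : ℝ => ∏ k : Fin K, lam (σ k) * h (σ k) ^ C / ∑ j ∈ S k, lam j * h j ^ C)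
      atTop (nhds 1) := by
  rw [← prod_const_one (s := (univ : Finset (Fin K)))]
  refine tendsto_finsetProd _ fun k _ => ?_
  refine tendsto_weighted_rpow_div_sum ?_ (fun j _ => hpos j) (lampos _).ne' ?_
  · rw [hS, mem_filter]
    exact ⟨mem_univ _, fun l hl heq => (hdesc l k hl).ne (congrArg h heq)⟩
  · intro j hj hne
    rw [hS, mem_filter] at hj
    by_cases hr : j ∈ Set.range σ
    · obtain ⟨l, rfl⟩ := hr
      rcases lt_trichotomy l k with hl | rfl | hl
      · exact absurd rfl (hj.2 l hl)
      · exact absurd rfl hne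
      · exact hdesc k l hl
    · exact htop j hr k
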